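/- Let P ⊆ A be a finite-index inclusion of unital C*-algebras with the Rohlin property. If A has real rank zero (invertible self-adjoint elements are dense in self-adjoint elements), then P has real rank zero. -/

import Mathlib

/-- A conditional expectation from a unital C*-algebra `A` onto a C*-subalgebra `P`. -/
structure IsCondExp {A : Type*} [NormedRing A] [StarRing A] [CStarRing A]
    [NormedAlgebra ℂ A] [CompleteSpace A] [StarModule ℂ A] [PartialOrder A]
    [StarOrderedRing A] (P : StarSubalgebra ℂ A) (E : A → A) : Prop where
  map_add : ∀ x y : A, E (x + y) = E x + E y
  map_smul : ∀ (c : ℂ) (x : A), E (c • x) = c • E x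
  mem : ∀ x : A, E x ∈ P
  fix : ∀ x ∈ P, E x = x
  bimod : ∀ p ∈ P, ∀ q ∈ P, ∀ x : A, E (p * x * q) = p * E x * q
  star_map : ∀ x : A, E (star x) = star (E x)
  pos : ∀ x : A, 0 ≤ E (star x * x)

/-- A quasi-basis `{(u i, v i)}` for a conditional expectation `E`. -/
def IsQuasiBasis {A : Type*} [Ring A] (E : A → A) {n : ℕ} (u v : Fin n → A) : Prop :=
  ∀ a : A, (a = ∑ i, u i * E (v i * a)) ∧ (a = ∑ i, E (a * u i) * v i)

/-- A sequence `(a n)` in a normed space is bounded. -/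
def IsBddSeq {A : Type*} [Norm A] (a : ℕ → A) : Prop := ∃ C : ℝ, ∀ n, ‖a n‖ ≤ C

/-- Data exhibiting the algebra `Ainf` as the quotient `A^∞ = ℓ^∞(ℕ, A)/c₀(A)` of
bounded sequences in `A` modulo null sequences; `q` is the quotient map (its values
on unbounded sequences are irrelevant). -/
structure SeqAlg (A : Type*) [NormedRing A] [StarRing A] [NormedAlgebra ℂ A]
    (Ainf : Type*) [Ring Ainf] [StarRing Ainf] [Algebra ℂ Ainf] where
  q : (ℕ → A) → Ainf
  surj : ∀ z : Ainf, ∃ a : ℕ → A, IsBddSeq a ∧ q a = z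
  q_add : ∀ a b : ℕ → A, IsBddSeq a → IsBddSeq b → q (a + b) = q a + q b
  q_mul : ∀ a b : ℕ → A, IsBddSeq a → IsBddSeq b → q (a * b) = q a * q b
  q_smul : ∀ (c : ℂ) (a : ℕ → A), IsBddSeq a → q (c • a) = c • q a
  q_star : ∀ a : ℕ → A, IsBddSeq a → q (star a) = star (q a)
  q_one : q 1 = 1
  q_eq_zero_iff : ∀ a : ℕ → A, IsBddSeq a →
    (q a = 0 ↔ Filter.Tendsto (fun n => ‖a n‖) Filter.atTop (nhds 0))

/-- The canonical embedding of `A` into `Ainf` as (classes of) constant sequences. -/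
def SeqAlg.incl {A : Type*} [NormedRing A] [StarRing A] [NormedAlgebra ℂ A]
    {Ainf : Type*} [Ring Ainf] [StarRing Ainf] [Algebra ℂ Ainf]
    (S : SeqAlg A Ainf) (x : A) : Ainf := S.q fun _ => x

/-- The hypotheses that `P ⊆ A` is an inclusion of unital C*-algebras with a
conditional expectation `E : A → P` of finite Watatani index (witnessed by a
quasi-basis with index sum `ind`, a central positive invertible element), having the
Rohlin property: there is a projection `e ∈ A_∞ = A^∞ ∩ A'` with
`E^∞(e) = (Index E)⁻¹ · 1` such that `x ↦ x e` is injective on `A`.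
Here `Ainf` plays the role of `A^∞ = ℓ^∞(ℕ,A)/c₀(A)` via `S : SeqAlg A Ainf`, and
`Einf` is the coordinatewise extension `E^∞`. -/
structure RohlinInclusion {A : Type*} [NormedRing A] [StarRing A] [CStarRing A]
    [NormedAlgebra ℂ A] [CompleteSpace A] [StarModule ℂ A] [PartialOrder A]
    [StarOrderedRing A] (P : StarSubalgebra ℂ A) (E : A → A)
    {Ainf : Type*} [Ring Ainf] [StarRing Ainf] [Algebra ℂ Ainf]
    (S : SeqAlg A Ainf) (Einf : Ainf → Ainf) where
  condExp : IsCondExp P E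
  -- finite index witnessed by a quasi-basis
  ind : A
  indInv : A
  quasiBasis : ∃ (n : ℕ) (u v : Fin n → A), IsQuasiBasis E u v ∧ ∑ i, u i * v i = ind
  ind_mem : ind ∈ P
  ind_central : ∀ a : A, Commute ind a
  ind_pos : 0 ≤ ind
  ind_mul_inv : ind * indInv = 1
  inv_mul_ind : indInv * ind = 1
  -- `E^∞` extends `E` coordinatewise
  Einf_compat : ∀ a : ℕ → A, IsBddSeq a → Einf (S.q a) = S.q fun n => E (a n)
  -- the Rohlin projection
  e : Ainf
  e_idem : e * e = e
  e_star : star e = e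
  e_comm : ∀ x : A, Commute e (S.incl x)
  e_exp : Einf e = S.incl indInv
  e_inj : ∀ x : A, S.incl x * e = 0 → x = 0


open Filter Topology

/-- A self-adjoint element `K` has a self-adjoint square root as soon as the cube of its negative
part vanishes; here `H ^ 2 = -N * K * N` is that cube, with `N` the negative part of `K`. -/
lemma IsSelfAdjoint.exists_sqrt_of_negPart {M : Type*} [CStarAlgebra M] {K : M}
    (hK : IsSelfAdjoint K) :
    ∃ N H R : M, IsSelfAdjoint N ∧ IsSelfAdjoint H ∧ IsSelfAdjoint R ∧ H * H + N * K * N = 0 ∧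
      (H = 0 → R * R = K) := by
  have hid : cfc (fun x : ℝ ↦ x) K = K := cfc_id' ℝ K
  refine ⟨cfc (fun x : ℝ ↦ max (-x) 0) K, cfc (fun x : ℝ ↦ √(max (-x) 0) * max (-x) 0) K,
    cfc (fun x : ℝ ↦ √x) K, cfc_predicate _ _, cfc_predicate _ _, cfc_predicate _ _, ?_,
    fun hH0 ↦ ?_⟩
  · have h2 : cfc (fun x : ℝ ↦ max (-x) 0) K * K * cfc (fun x : ℝ ↦ max (-x) 0) K =
        cfc (fun x : ℝ ↦ max (-x) 0 * x * max (-x) 0) K := by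
      rw [cfc_mul _ _ K, cfc_mul _ _ K, hid]
    rw [← cfc_mul _ _ K, h2, ← cfc_add K _ _, ← cfc_const_zero ℝ K]
    refine cfc_congr fun x _ ↦ ?_
    have : √(max (-x) 0) * √(max (-x) 0) = max (-x) 0 := Real.mul_self_sqrt (le_max_right _ _)
    rcases le_total 0 x with hx | hx
    · simp [hx]
    · simp only [Left.nonneg_neg_iff, hx, sup_of_le_left] at this ⊢
      linear_combination x * x * this
  · rw [← cfc_mul _ _ K]
    conv_rhs => rw [← hid]
    rw [← cfc_const_zero ℝ K, cfc_eq_cfc_iff_eqOn] at hH0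
    refine cfc_congr fun x hx ↦ ?_
    have h2 := hH0 hx
    simp only at h2
    rcases le_total 0 x with hx | hx
    · exact Real.mul_self_sqrt hx
    · have : x = 0 := by
        rcases mul_eq_zero.mp h2 with h | h
        · rw [Real.sqrt_eq_zero (le_max_right _ _)] at h
          linarith [le_max_left (-x) 0]
        · linarith [le_max_left (-x) 0]
      simp [this]

namespace IsCondExp

variable {A : Type*} [CStarAlgebra A] [PartialOrder A] [StarOrderedRing A]
  {P : StarSubalgebra ℂ A} {E : A → A}

/-- A conditional expectation as a linear map. -/
def toLinearMap (hE : IsCondExp P E) : A →ₗ[ℂ] A where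
  toFun := E
  map_add' := hE.map_add
  map_smul' := hE.map_smul

lemma map_nonneg (hE : IsCondExp P E) {x : A} (hx : 0 ≤ x) : 0 ≤ E x := by
  obtain ⟨y, rfl⟩ := CStarAlgebra.nonneg_iff_eq_star_mul_self.mp hx
  exact hE.pos y

lemma exists_bound (hE : IsCondExp P E) : ∃ C : ℝ, 0 ≤ C ∧ ∀ a, ‖E a‖ ≤ C * ‖a‖ := by
  obtain ⟨C, hC⟩ := PositiveLinearMap.exists_norm_apply_le
    (PositiveLinearMap.mk₀ hE.toLinearMap fun _ hx ↦ hE.map_nonneg hx)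
  exact ⟨C, C.2, hC⟩

lemma isClosed (hE : IsCondExp P E) : IsClosed (P : Set A) := by
  obtain ⟨C, -, hC⟩ := hE.exists_bound
  have hcont : Continuous E := (LinearMap.mkContinuous hE.toLinearMap C hC).continuous
  convert isClosed_eq hcont continuous_id using 1
  ext x
  exact ⟨fun hx ↦ hE.fix x hx, fun hx ↦ by simpa [show E x = x from hx] using hE.mem x⟩

lemma map_mul_left (hE : IsCondExp P E) {p : A} (hp : p ∈ P) (x : A) : E (p * x) = p * E x := by
  simpa using hE.bimod p hp 1 (one_mem P) x

lemma map_mul_right (hE : IsCondExp P E) {p : A} (hp : p ∈ P) (x : A) : E (x * p) = E x * p := by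
  simpa using hE.bimod 1 (one_mem P) p hp x

lemma map_sum (hE : IsCondExp P E) {ι : Type*} (s : Finset ι) (f : ι → A) :
    E (∑ i ∈ s, f i) = ∑ i ∈ s, E (f i) := _root_.map_sum hE.toLinearMap f s

/-- The matrix `E (v i * star (v j))` has a square root with entries in the subalgebra. -/
lemma exists_matrix_sqrt (hE : IsCondExp P E) {n : ℕ} (v : Fin n → A) :
    ∃ R : Fin n → Fin n → A, (∀ i j, R i j ∈ P) ∧ (∀ i j, star (R i j) = R j i) ∧
      ∀ i j, ∑ k, R i k * R k j = E (v i * star (v j)) := by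
  have : IsClosed (P : Set A) := hE.isClosed
  let _ : CStarAlgebra P := StarSubalgebra.cstarAlgebra P
  let _ : PartialOrder P := CStarAlgebra.spectralOrder P
  have : StarOrderedRing P := CStarAlgebra.spectralOrderedRing P
  let K : CStarMatrix (Fin n) (Fin n) P :=
    CStarMatrix.ofMatrix fun i j ↦ ⟨E (v i * star (v j)), hE.mem _⟩
  have hKe (i j) : (K i j : A) = E (v i * star (v j)) := rfl
  have hK : IsSelfAdjoint K := by
    ext i j
    rw [CStarMatrix.star_apply]
    simp [hKe, ← hE.star_map]
  obtain ⟨N, H, R, hN, hH, hR, hHH, hRR⟩ :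
      ∃ N H R : CStarMatrix (Fin n) (Fin n) P, IsSelfAdjoint N ∧ IsSelfAdjoint H ∧
        IsSelfAdjoint R ∧ H * H + N * K * N = 0 ∧ (H = 0 → R * R = K) :=
    IsSelfAdjoint.exists_sqrt_of_negPart (M := CStarMatrix (Fin n) (Fin n) P) (K := K) hK
  have hst {M : CStarMatrix (Fin n) (Fin n) P} (hM : IsSelfAdjoint M) (i j : Fin n) :
      star (M i j : A) = M j i := by
    rw [← CStarMatrix.star_apply_of_isSelfAdjoint hM (i := j) (j := i)]
    exact star_star (M j i : A)
  have hH0 : H = 0 := by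
    have key (i : Fin n) : ∑ j, (H i j : A) * star (H i j : A) +
        E ((∑ j, (N i j : A) * v j) * star (∑ j, (N i j : A) * v j)) = 0 := by
      have := congrArg (fun M : CStarMatrix (Fin n) (Fin n) P ↦ (M i i : A)) hHH
      simp only [CStarMatrix.add_apply, CStarMatrix.mul_apply, CStarMatrix.zero_apply] at this
      push_cast at this
      rw [← this]
      congr 1
      · refine Finset.sum_congr rfl fun j _ ↦ ?_
        rw [hst hH]
      · simp only [star_sum, star_mul, Finset.sum_mul, Finset.mul_sum, hE.map_sum]
        refine Finset.sum_congr rfl fun j _ ↦ Finset.sum_congr rfl fun k _ ↦ ?_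
        rw [hst hN, hKe, ← hE.bimod _ (N i k).2 _ (N j i).2]
        simp only [mul_assoc]
    ext i j
    have h0 := (add_eq_zero_iff_of_nonneg
      (Finset.sum_nonneg fun j _ ↦ mul_star_self_nonneg (H i j : A))
      (hE.map_nonneg (mul_star_self_nonneg _))).mp (key i)
    have h1 := (Finset.sum_eq_zero_iff_of_nonneg
      fun j _ ↦ mul_star_self_nonneg (H i j : A)).mp h0.1 j (Finset.mem_univ j)
    simpa using CStarRing.mul_star_self_eq_zero_iff _ |>.mp h1
  refine ⟨fun i j ↦ R i j, fun i j ↦ (R i j).2, fun i j ↦ ?_, fun i j ↦ ?_⟩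
  · exact hst hR i j
  · rw [← hKe, ← hRR hH0, CStarMatrix.mul_apply]
    push_cast
    rfl

/-- Any quasi-basis can be replaced by one of the form `(w, star w)` with the same index. -/
lemma exists_star_quasiBasis (hE : IsCondExp P E) {n : ℕ} {u v : Fin n → A}
    (h : IsQuasiBasis E u v) :
    ∃ w : Fin n → A, (∀ a, ∑ i, w i * E (star (w i) * a) = a) ∧
      ∑ i, w i * star (w i) = ∑ i, u i * v i := by
  obtain ⟨R, hRP, hRs, hRR⟩ := hE.exists_matrix_sqrt v
  have hsum (f : Fin n → A) : ∑ j, (∑ i, u i * R i j) * (∑ k, R j k * f k) =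
      ∑ i, u i * ∑ k, E (v i * star (v k)) * f k := by
    simp only [← hRR, Finset.sum_mul_sum]
    rw [Finset.sum_comm]
    refine Finset.sum_congr rfl fun i _ ↦ ?_
    rw [Finset.sum_comm]
    simp only [Finset.sum_mul, Finset.mul_sum, mul_assoc]
  have hv (x : A) : ∑ k, star (v k) * E (star (u k) * x) = x := by
    have := congrArg star (h (star x)).2
    simpa [star_sum, ← hE.star_map] using this.symm
  refine ⟨fun j ↦ ∑ i, u i * R i j, fun a ↦ ?_, ?_⟩
  · have h1 (j) : E (star (∑ i, u i * R i j) * a) = ∑ k, R j k * E (star (u k) * a) := by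
      simp only [star_sum, star_mul, hRs, Finset.sum_mul, hE.map_sum, mul_assoc,
        hE.map_mul_left (hRP _ _)]
    simp only [h1, hsum]
    conv_rhs => rw [(h a).1]
    refine Finset.sum_congr rfl fun i _ ↦ ?_
    conv_rhs => rw [← hv a]
    simp only [Finset.mul_sum, hE.map_sum, ← mul_assoc, hE.map_mul_right (hE.mem _)]
  · have h1 (j) : star (∑ i, u i * R i j) = ∑ k, R j k * star (u k) := by
      simp only [star_sum, star_mul, hRs]
    simp only [h1, hsum]
    refine Finset.sum_congr rfl fun i _ ↦ ?_
    have := congrArg star (h (star (v i))).1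
    simp only [star_sum, star_mul, star_star, ← hE.star_map] at this
    rw [← this]

end IsCondExp

section RohlinElement

variable {R : Type*} [Ring R] [StarRing R] {F : R →+ R} {e g : R}

/-- An element `e` whose expectation inverts the index satisfies `e * z = e * (g * F (e * z))`. -/
lemma mul_eq_mul_index_mul_map (hFs : ∀ z, F (star z) = star (F z))
    (hF : ∀ x y, F (x * F y) = F x * F y) (he : e * e = e) (hes : star e = e)
    (hgs : star g = g) (hgc : ∀ z, Commute g z) (hge : g * F e = 1)
    {ι : Type*} [Fintype ι] {w : ι → R} (hw : ∀ z, ∑ i, w i * F (star (w i) * z) = z)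
    (hwg : ∑ i, w i * star (w i) = g)
    (hsq : ∀ x : ι → R, ∑ i, x i * star (x i) = 0 → ∀ i, x i = 0) (z : R) :
    e * z = e * (g * F (e * z)) := by
  have hwe (i : ι) : e * w i - e * (g * F (e * w i)) = 0 := by
    refine hsq (fun i ↦ e * w i - e * (g * F (e * w i))) ?_ i
    have hs (i : ι) : star (F (e * w i)) = F (star (w i) * e) := by
      rw [← hFs, star_mul, hes]
    have h1 : ∑ i, e * w i * (star (w i) * e) = g * e := by
      calc ∑ i, e * w i * (star (w i) * e) = e * (∑ i, w i * star (w i)) * e := by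
            simp only [Finset.mul_sum, Finset.sum_mul, mul_assoc]
        _ = g * e := by rw [hwg, ← (hgc e).eq, mul_assoc, he]
    have h2 : ∑ i, e * w i * (F (star (w i) * e) * g * e) = g * e := by
      calc ∑ i, e * w i * (F (star (w i) * e) * g * e)
          = e * (∑ i, w i * F (star (w i) * e)) * g * e := by
            simp only [Finset.mul_sum, Finset.sum_mul, mul_assoc]
        _ = g * e := by rw [hw, he, ← (hgc e).eq, mul_assoc, he]
    have h3 : ∑ i, e * (g * F (e * w i)) * (star (w i) * e) = g * e := by
      have := congrArg star h2
      simp only [star_sum, star_mul, hes, hgs, ← hFs, star_star] at this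
      simpa only [mul_assoc, (hgc e).eq] using this
    have h4 : ∑ i, e * (g * F (e * w i)) * (F (star (w i) * e) * g * e) = g * e := by
      calc ∑ i, e * (g * F (e * w i)) * (F (star (w i) * e) * g * e)
          = e * (g * F (e * ∑ i, w i * F (star (w i) * e))) * g * e := by
            simp only [Finset.mul_sum, map_sum, ← mul_assoc, hF, Finset.sum_mul]
        _ = g * e := by rw [hw, he, hge, mul_one, ← (hgc e).eq, mul_assoc, he]
    simp only [star_sub, star_mul, hs, hes, hgs, sub_mul, mul_sub, Finset.sum_sub_distrib,
      h1, h2, h3, h4, sub_self]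
  calc e * z = e * ∑ i, w i * F (star (w i) * z) := by rw [hw]
    _ = ∑ i, e * (g * F (e * w i)) * F (star (w i) * z) := by
      rw [Finset.mul_sum]
      exact Finset.sum_congr rfl fun i _ ↦ by
        rw [← mul_assoc]
        exact congrArg (· * _) (sub_eq_zero.mp (hwe i))
    _ = e * (g * F (e * ∑ i, w i * F (star (w i) * z))) := by
      simp only [Finset.mul_sum, map_sum, ← mul_assoc, hF]
    _ = e * (g * F (e * z)) := by rw [hw]

/-- On the commutant of `e`, the map `z ↦ g * F (e * z)` is multiplicative. -/
lemma index_mul_map_mul (hFs : ∀ z, F (star z) = star (F z))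
    (hF : ∀ x y, F (x * F y) = F x * F y) (hes : star e = e)
    (hgs : star g = g) (hgc : ∀ z, Commute g z) (hgF : ∀ z, F (g * z) = g * F z)
    (hez : ∀ z, e * z = e * (g * F (e * z))) {x y : R} (hx : Commute e x) :
    g * F (e * x) * (g * F (e * y)) = g * F (e * (x * y)) := by
  have hF' (x y : R) : F (F x * y) = F x * F y := by
    have := congrArg star (hF (star y) (star x))
    simpa [← hFs] using this
  have hxe : x * e = g * F (e * x) * e := by
    have := congrArg star (hez (star x))
    simp only [star_mul, star_star, hes, ← hFs, hgs] at this
    rw [this, (hgc _).eq, hx.eq]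
  calc g * F (e * x) * (g * F (e * y)) = g * (g * F (F (e * x) * (e * y))) := by
        rw [hF', mul_assoc, ((hgc (F (e * x))).symm).left_comm]
    _ = g * F (x * e * y) := by rw [hxe, ← hgF]; simp only [mul_assoc]
    _ = g * F (e * (x * y)) := by rw [← hx.eq, mul_assoc]

end RohlinElement

section IsBddSeq

variable {A : Type*} [CStarAlgebra A] {a b : ℕ → A}

lemma isBddSeq_const (x : A) : IsBddSeq fun _ : ℕ ↦ x := ⟨‖x‖, fun _ ↦ le_rfl⟩

lemma IsBddSeq.exists_nonneg (ha : IsBddSeq a) : ∃ C : ℝ, 0 ≤ C ∧ ∀ n, ‖a n‖ ≤ C :=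
  let ⟨C, hC⟩ := ha
  ⟨C, (norm_nonneg _).trans (hC 0), hC⟩

lemma IsBddSeq.add (ha : IsBddSeq a) (hb : IsBddSeq b) : IsBddSeq (a + b) := by
  obtain ⟨C, hC⟩ := ha
  obtain ⟨D, hD⟩ := hb
  exact ⟨C + D, fun n ↦ (norm_add_le _ _).trans (add_le_add (hC n) (hD n))⟩

lemma IsBddSeq.mul (ha : IsBddSeq a) (hb : IsBddSeq b) : IsBddSeq (a * b) := by
  obtain ⟨C, hC0, hC⟩ := ha.exists_nonneg
  obtain ⟨D, hD⟩ := hb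
  exact ⟨C * D, fun n ↦ (norm_mul_le _ _).trans
    (mul_le_mul (hC n) (hD n) (norm_nonneg _) hC0)⟩

lemma IsBddSeq.star (ha : IsBddSeq a) : IsBddSeq (star a) := by
  obtain ⟨C, hC⟩ := ha
  exact ⟨C, fun n ↦ by simpa using hC n⟩

lemma IsBddSeq.smul (c : ℂ) (ha : IsBddSeq a) : IsBddSeq (c • a) := by
  obtain ⟨C, hC⟩ := ha
  exact ⟨‖c‖ * C, fun n ↦ by
    simpa [norm_smul] using mul_le_mul_of_nonneg_left (hC n) (norm_nonneg c)⟩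

lemma IsBddSeq.sub (ha : IsBddSeq a) (hb : IsBddSeq b) : IsBddSeq (a - b) := by
  convert ha.add (hb.smul (-1)) using 1
  simp [sub_eq_add_neg]

lemma IsBddSeq.sum {ι : Type*} (s : Finset ι) {f : ι → ℕ → A} (hf : ∀ i, IsBddSeq (f i)) :
    IsBddSeq (∑ i ∈ s, f i) := by
  classical
  induction s using Finset.induction_on with
  | empty => exact isBddSeq_const (0 : A)
  | insert i s hi ih => simpa [Finset.sum_insert hi] using (hf i).add ih

lemma IsCondExp.isBddSeq [PartialOrder A] [StarOrderedRing A] {P : StarSubalgebra ℂ A}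
    {E : A → A} (hE : IsCondExp P E) (ha : IsBddSeq a) : IsBddSeq fun n ↦ E (a n) := by
  obtain ⟨C, hC0, hC⟩ := hE.exists_bound
  obtain ⟨D, hD⟩ := ha
  exact ⟨C * D, fun n ↦ (hC _).trans (mul_le_mul_of_nonneg_left (hD n) hC0)⟩

end IsBddSeq

namespace SeqAlg

variable {A : Type*} [CStarAlgebra A] {Ainf : Type*} [Ring Ainf] [StarRing Ainf]
  [Algebra ℂ Ainf] (S : SeqAlg A Ainf)

lemma q_sub {a b : ℕ → A} (ha : IsBddSeq a) (hb : IsBddSeq b) : S.q (a - b) = S.q a - S.q b := by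
  have := S.q_add a ((-1 : ℂ) • b) ha (hb.smul _)
  rw [S.q_smul _ _ hb] at this
  simpa [sub_eq_add_neg] using this

lemma q_eq_iff {a b : ℕ → A} (ha : IsBddSeq a) (hb : IsBddSeq b) :
    S.q a = S.q b ↔ Tendsto (fun n ↦ ‖a n - b n‖) atTop (𝓝 0) := by
  rw [← sub_eq_zero, ← S.q_sub ha hb, S.q_eq_zero_iff _ (ha.sub hb)]
  rfl

lemma q_zero : S.q 0 = 0 := by
  rw [S.q_eq_zero_iff 0 (isBddSeq_const (0 : A))]
  simp

lemma q_sum {ι : Type*} (s : Finset ι) {f : ι → ℕ → A} (hf : ∀ i, IsBddSeq (f i)) :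
    S.q (∑ i ∈ s, f i) = ∑ i ∈ s, S.q (f i) := by
  classical
  induction s using Finset.induction_on with
  | empty => simpa using S.q_zero
  | insert i s hi ih =>
    rw [Finset.sum_insert hi, Finset.sum_insert hi, S.q_add _ _ (hf i) (.sum s hf), ih]

lemma incl_mul (x y : A) : S.incl (x * y) = S.incl x * S.incl y :=
  S.q_mul _ _ (isBddSeq_const x) (isBddSeq_const y)

lemma incl_star (x : A) : S.incl (star x) = star (S.incl x) :=
  S.q_star _ (isBddSeq_const x)

lemma incl_one : S.incl 1 = 1 := S.q_one

lemma incl_sum {ι : Type*} (s : Finset ι) (f : ι → A) :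
    S.incl (∑ i ∈ s, f i) = ∑ i ∈ s, S.incl (f i) := by
  rw [SeqAlg.incl, show (fun _ : ℕ ↦ ∑ i ∈ s, f i) = ∑ i ∈ s, fun _ ↦ f i by ext; simp,
    S.q_sum s fun i ↦ isBddSeq_const (f i)]
  rfl

lemma commute_incl {x : A} (hx : ∀ a, Commute x a) (z : Ainf) : Commute (S.incl x) z := by
  obtain ⟨a, ha, rfl⟩ := S.surj z
  rw [commute_iff_eq, SeqAlg.incl, ← S.q_mul _ _ (isBddSeq_const x) ha,
    ← S.q_mul _ _ ha (isBddSeq_const x)]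
  exact congrArg S.q (funext fun n ↦ (hx (a n)).eq)

lemma eq_zero_of_sum_mul_star_eq_zero (S : SeqAlg A Ainf) {ι : Type*} [Fintype ι] (x : ι → Ainf)
    (h : ∑ i, x i * star (x i) = 0) (i : ι) : x i = 0 := by
  choose a ha hq using fun i ↦ S.surj (x i)
  have hb (i : ι) : IsBddSeq (a i * star (a i)) := (ha i).mul (ha i).star
  simp only [← hq, ← S.q_star _ (ha _), ← S.q_mul _ _ (ha _) (ha _).star, ← S.q_sum _ hb,
    S.q_eq_zero_iff _ (IsBddSeq.sum _ hb)] at h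
  rw [← hq, S.q_eq_zero_iff _ (ha i)]
  have h2 : Tendsto (fun n ↦ √‖(∑ i, a i * star (a i)) n‖) atTop (𝓝 0) := by
    simpa using h.sqrt
  refine squeeze_zero (fun _ ↦ norm_nonneg _) (fun n ↦ ?_) h2
  let _ := CStarAlgebra.spectralOrder A
  have := CStarAlgebra.spectralOrderedRing A
  refine Real.le_sqrt_of_sq_le ?_
  rw [sq, ← CStarRing.norm_self_mul_star, Finset.sum_apply]
  exact CStarAlgebra.norm_le_norm_of_nonneg_of_le (mul_star_self_nonneg _)
    (Finset.single_le_sum (f := fun i ↦ a i n * star (a i n))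
      (fun i _ ↦ mul_star_self_nonneg _) (Finset.mem_univ i))

end SeqAlg

namespace RohlinInclusion

variable {A : Type*} [CStarAlgebra A] [PartialOrder A] [StarOrderedRing A]
  {P : StarSubalgebra ℂ A} {E : A → A} {Ainf : Type*} [Ring Ainf] [StarRing Ainf]
  [Algebra ℂ Ainf] {S : SeqAlg A Ainf} {Einf : Ainf → Ainf}

/-- The coordinatewise extension of the conditional expectation as an additive map. -/
def einfHom (h : RohlinInclusion P E S Einf) : Ainf →+ Ainf :=
  AddMonoidHom.mk' Einf fun x y ↦ by
    obtain ⟨a, ha, rfl⟩ := S.surj x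
    obtain ⟨b, hb, rfl⟩ := S.surj y
    rw [← S.q_add _ _ ha hb, h.Einf_compat _ (ha.add hb), h.Einf_compat _ ha,
      h.Einf_compat _ hb, ← S.q_add _ _ (h.condExp.isBddSeq ha) (h.condExp.isBddSeq hb)]
    exact congrArg S.q (funext fun n ↦ h.condExp.map_add _ _)

lemma einf_star (h : RohlinInclusion P E S Einf) (z : Ainf) :
    Einf (star z) = star (Einf z) := by
  obtain ⟨a, ha, rfl⟩ := S.surj z
  rw [← S.q_star _ ha, h.Einf_compat _ ha.star, h.Einf_compat _ ha,
    ← S.q_star _ (h.condExp.isBddSeq ha)]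
  exact congrArg S.q (funext fun n ↦ h.condExp.star_map _)

lemma einf_mul_einf (h : RohlinInclusion P E S Einf) (x y : Ainf) :
    Einf (x * Einf y) = Einf x * Einf y := by
  obtain ⟨a, ha, rfl⟩ := S.surj x
  obtain ⟨b, hb, rfl⟩ := S.surj y
  have hb' := h.condExp.isBddSeq hb
  rw [h.Einf_compat _ hb, ← S.q_mul _ _ ha hb', h.Einf_compat _ (ha.mul hb'),
    h.Einf_compat _ ha, ← S.q_mul _ _ (h.condExp.isBddSeq ha) hb']
  exact congrArg S.q (funext fun n ↦ h.condExp.map_mul_right (h.condExp.mem _) _)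

lemma einf_incl_mul (h : RohlinInclusion P E S Einf) {p : A} (hp : p ∈ P) (z : Ainf) :
    Einf (S.incl p * z) = S.incl p * Einf z := by
  obtain ⟨a, ha, rfl⟩ := S.surj z
  have hb := isBddSeq_const p
  rw [h.Einf_compat _ ha, SeqAlg.incl, ← S.q_mul _ _ hb ha, h.Einf_compat _ (hb.mul ha),
    ← S.q_mul _ _ hb (h.condExp.isBddSeq ha)]
  exact congrArg S.q (funext fun n ↦ h.condExp.map_mul_left hp _)

lemma sum_incl_mul_einf (h : RohlinInclusion P E S Einf) {ι : Type*} [Fintype ι] {w : ι → A}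
    (hw : ∀ a, ∑ i, w i * E (star (w i) * a) = a) (z : Ainf) :
    ∑ i, S.incl (w i) * Einf (star (S.incl (w i)) * z) = z := by
  obtain ⟨a, ha, rfl⟩ := S.surj z
  have hb (i : ι) := isBddSeq_const (w i)
  have hc (i : ι) := isBddSeq_const (star (w i))
  have hd (i : ι) : IsBddSeq fun n ↦ E (star (w i) * a n) :=
    h.condExp.isBddSeq ((hc i).mul ha)
  have (i : ι) : S.incl (w i) * Einf (star (S.incl (w i)) * S.q a) =
      S.q ((fun _ ↦ w i) * fun n ↦ E (star (w i) * a n)) := by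
    rw [← S.incl_star, SeqAlg.incl, SeqAlg.incl, ← S.q_mul _ _ (hc i) ha,
      h.Einf_compat _ ((hc i).mul ha)]
    exact (S.q_mul _ _ (hb i) (hd i)).symm
  simp only [this]
  rw [← S.q_sum _ fun i ↦ (hb i).mul (hd i)]
  refine congrArg S.q (funext fun n ↦ ?_)
  simpa using hw (a n)

/-- The map `a ↦ Index E * Einf (e * a)` from `A` to the sequence algebra of `P`. -/
def beta (h : RohlinInclusion P E S Einf) (a : A) : Ainf :=
  S.incl h.ind * Einf (h.e * S.incl a)

lemma star_ind (h : RohlinInclusion P E S Einf) : star h.ind = h.ind :=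
  (IsSelfAdjoint.of_nonneg h.ind_pos).star_eq

lemma incl_ind_mul_einf (h : RohlinInclusion P E S Einf) : S.incl h.ind * Einf h.e = 1 := by
  rw [h.e_exp, ← S.incl_mul, h.ind_mul_inv, S.incl_one]

lemma beta_star (h : RohlinInclusion P E S Einf) (a : A) : h.beta (star a) = star (h.beta a) := by
  rw [beta, beta, star_mul, ← h.einf_star, star_mul, h.e_star, ← S.incl_star, ← S.incl_star,
    h.star_ind, (h.e_comm _).eq, (S.commute_incl h.ind_central _).eq]

lemma beta_of_mem (h : RohlinInclusion P E S Einf) {p : A} (hp : p ∈ P) :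
    h.beta p = S.incl p := by
  rw [beta, (h.e_comm p).eq, h.einf_incl_mul hp, (S.commute_incl h.ind_central _).left_comm,
    h.incl_ind_mul_einf, mul_one]

lemma beta_mul (h : RohlinInclusion P E S Einf) (a b : A) :
    h.beta (a * b) = h.beta a * h.beta b := by
  obtain ⟨n, u, v, huv, hind⟩ := h.quasiBasis
  obtain ⟨w, hw, hws⟩ := h.condExp.exists_star_quasiBasis huv
  have hgs : star (S.incl h.ind) = S.incl h.ind := by rw [← S.incl_star, h.star_ind]
  have hez := mul_eq_mul_index_mul_map (F := h.einfHom) h.einf_star h.einf_mul_einf h.e_idem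
    h.e_star hgs (S.commute_incl h.ind_central) h.incl_ind_mul_einf
    (h.sum_incl_mul_einf hw)
    (by simp only [← S.incl_star, ← S.incl_mul, ← S.incl_sum, hws, hind])
    (S.eq_zero_of_sum_mul_star_eq_zero)
  have := index_mul_map_mul (F := h.einfHom) h.einf_star h.einf_mul_einf h.e_star hgs
    (S.commute_incl h.ind_central) (h.einf_incl_mul h.ind_mem) hez (h.e_comm a)
    (y := S.incl b)
  rw [beta, beta, beta, S.incl_mul]
  exact this.symm

lemma exists_lift_beta (h : RohlinInclusion P E S Einf) :
    ∃ (b : A → ℕ → A) (C : ℝ), 0 < C ∧ (∀ a n, b a n ∈ P) ∧ (∀ a, S.q (b a) = h.beta a) ∧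
      (∀ a c n, ‖b a n - b c n‖ ≤ C * ‖a - c‖) ∧ ∀ a, IsBddSeq (b a) := by
  obtain ⟨f, hf, hfe⟩ := S.surj h.e
  obtain ⟨C, hC0, hC⟩ := h.condExp.exists_bound
  obtain ⟨D, hD0, hD⟩ := hf.exists_nonneg
  have hmul (a : A) : IsBddSeq fun n ↦ f n * a := hf.mul (isBddSeq_const a)
  have hb (a : A) : IsBddSeq fun n ↦ E (f n * a) := h.condExp.isBddSeq (hmul a)
  refine ⟨fun a n ↦ h.ind * E (f n * a), ‖h.ind‖ * (C * D) + 1, by positivity,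
    fun a n ↦ mul_mem h.ind_mem (h.condExp.mem _), fun a ↦ ?_, fun a c n ↦ ?_,
    fun a ↦ (isBddSeq_const h.ind).mul (hb a)⟩
  · rw [beta, ← hfe, SeqAlg.incl, SeqAlg.incl, ← S.q_mul _ _ hf (isBddSeq_const a),
      h.Einf_compat _ (hf.mul (isBddSeq_const a))]
    exact S.q_mul _ _ (isBddSeq_const _) (hb a)
  · have hsub : h.ind * E (f n * a) - h.ind * E (f n * c) = h.ind * E (f n * (a - c)) := by
      rw [← mul_sub, mul_sub (f n)]
      exact congrArg _ (map_sub h.condExp.toLinearMap _ _).symm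
    calc ‖h.ind * E (f n * a) - h.ind * E (f n * c)‖
        ≤ ‖h.ind‖ * (C * (D * ‖a - c‖)) := by
          rw [hsub]
          refine (norm_mul_le _ _).trans ?_
          gcongr
          refine (hC _).trans ?_
          gcongr
          refine (norm_mul_le _ _).trans ?_
          gcongr
          exact hD n
      _ ≤ (‖h.ind‖ * (C * D) + 1) * ‖a - c‖ := by linarith [norm_nonneg (a - c)]

/-- Invertibility of a self-adjoint `y` passes to approximants in `P` of `beta y`. -/
theorem exists_isSelfAdjoint_invertible_near (h : RohlinInclusion P E S Einf)
    (hrr : ∀ x : A, star x = x → ∀ ε : ℝ, 0 < ε →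
      ∃ y : A, star y = y ∧ IsUnit y ∧ ‖x - y‖ < ε)
    {x : A} (hx : x ∈ P) (hxs : star x = x) {ε : ℝ} (hε : 0 < ε) :
    ∃ y ∈ P, star y = y ∧ (∃ z ∈ P, y * z = 1 ∧ z * y = 1) ∧ ‖x - y‖ < ε := by
  obtain ⟨b, C, hC0, hbP, hbq, hbn, hbb⟩ := h.exists_lift_beta
  obtain ⟨y, hys, ⟨u, rfl⟩, hxy⟩ := hrr x hxs (ε / 2 / C) (by positivity)
  let s : ℕ → A := (2⁻¹ : ℂ) • (b u + star (b u))
  have hss (n : ℕ) : star (s n) = s n := by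
    simp [s, add_comm]
  have hsP (n : ℕ) : s n ∈ P := SMulMemClass.smul_mem _ (add_mem (hbP _ n) (star_mem (hbP _ n)))
  have hsb : IsBddSeq s := ((hbb _).add (hbb _).star).smul _
  have hsq : S.q s = h.beta u := by
    rw [S.q_smul _ _ ((hbb _).add (hbb _).star), S.q_add _ _ (hbb _) (hbb _).star,
      S.q_star _ (hbb _), hbq, ← h.beta_star, hys, ← two_smul ℂ, smul_smul]
    simp
  have hb1 : h.beta 1 = S.q 1 := by
    rw [h.beta_of_mem (one_mem P), S.q_one, S.incl_one]
  have h1 : Tendsto (fun n ↦ ‖s n * b ↑u⁻¹ n - 1‖) atTop (𝓝 0) := by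
    refine (S.q_eq_iff (hsb.mul (hbb _)) (isBddSeq_const 1)).mp ?_
    rw [S.q_mul _ _ hsb (hbb _), hsq, hbq, ← h.beta_mul, u.mul_inv, hb1]
    rfl
  have h2 : Tendsto (fun n ↦ ‖b ↑u⁻¹ n * s n - 1‖) atTop (𝓝 0) := by
    refine (S.q_eq_iff ((hbb _).mul hsb) (isBddSeq_const 1)).mp ?_
    rw [S.q_mul _ _ (hbb _) hsb, hsq, hbq, ← h.beta_mul, u.inv_mul, hb1]
    rfl
  have h3 : Tendsto (fun n ↦ ‖b u n - s n‖) atTop (𝓝 0) :=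
    (S.q_eq_iff (hbb _) hsb).mp (by rw [hbq, hsq])
  have h4 : Tendsto (fun n ↦ ‖x - b x n‖) atTop (𝓝 0) :=
    (S.q_eq_iff (isBddSeq_const x) (hbb _)).mp (by rw [hbq, h.beta_of_mem hx]; rfl)
  obtain ⟨n, ⟨hn1, hn2⟩, hn3, hn4⟩ := ((h1.eventually_lt_const one_pos).and
    (h2.eventually_lt_const one_pos)).and ((h3.eventually_lt_const (by positivity : 0 < ε / 4)).and
    (h4.eventually_lt_const (by positivity : 0 < ε / 4))) |>.exists
  have hu : IsUnit (s n) := by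
    rw [norm_sub_rev] at hn1 hn2
    rw [isUnit_iff_exists_and_exists]
    constructor
    · refine ⟨b ↑u⁻¹ n * ↑(Units.oneSub _ hn1)⁻¹, ?_⟩
      rw [← mul_assoc, Units.mul_inv_eq_one]
      simp
    · refine ⟨↑(Units.oneSub _ hn2)⁻¹ * b ↑u⁻¹ n, ?_⟩
      rw [mul_assoc, Units.inv_mul_eq_one]
      simp
  obtain ⟨t, ht⟩ := hu
  have hE1 : E 1 = 1 := h.condExp.fix 1 (one_mem P)
  refine ⟨s n, hsP n, hss n, ⟨E ↑t⁻¹, h.condExp.mem _, ?_, ?_⟩, ?_⟩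
  · rw [← h.condExp.map_mul_left (hsP n), ← ht, t.mul_inv, hE1]
  · rw [← h.condExp.map_mul_right (hsP n), ← ht, t.inv_mul, hE1]
  · have hn5 : ‖b x n - b u n‖ < ε / 2 := by
      refine (hbn x u n).trans_lt ?_
      rwa [lt_div_iff₀' hC0] at hxy
    calc ‖x - s n‖ = ‖(x - b x n) + (b x n - b u n) + (b u n - s n)‖ := by congr 1; abel
      _ ≤ ‖x - b x n‖ + ‖b x n - b u n‖ + ‖b u n - s n‖ := norm_add₃_le
      _ < ε := by linarith

end RohlinInclusion

/-- let `P ⊆ A` be a finite-index inclusion of unital C*-algebras with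
the Rohlin property. If `A` has real rank zero (invertible self-adjoint elements are
dense in the self-adjoint elements), then `P` has real rank zero. -/
theorem rohlin_inclusion_real_rank_zero
    {A : Type*} [NormedRing A] [StarRing A] [CStarRing A] [NormedAlgebra ℂ A]
    [CompleteSpace A] [StarModule ℂ A] [PartialOrder A] [StarOrderedRing A]
    (P : StarSubalgebra ℂ A) (E : A → A)
    {Ainf : Type*} [Ring Ainf] [StarRing Ainf] [Algebra ℂ Ainf]
    (S : SeqAlg A Ainf) (Einf : Ainf → Ainf)
    (hRohlin : RohlinInclusion P E S Einf)
    (hrrA : ∀ x : A, star x = x → ∀ ε : ℝ, 0 < ε →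
      ∃ y : A, star y = y ∧ IsUnit y ∧ ‖x - y‖ < ε) :
    ∀ x ∈ P, star x = x → ∀ ε : ℝ, 0 < ε →
      ∃ y ∈ P, star y = y ∧ (∃ z ∈ P, y * z = 1 ∧ z * y = 1) ∧ ‖x - y‖ < ε := by
  let _ : CStarAlgebra A := { }
  intro x hx hxs ε hε
  exact hRohlin.exists_isSelfAdjoint_invertible_near hrrA hx hxs hε
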